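/- arXiv:2405.02081 — 2 statements merged into one kernel-verified Lean document; each statement's English description precedes it below -/
import Mathlib

section
/- Proposition 1 (InfoNCE lower bound on the client-conditional mutual information, discrete version): Let S be a random variable on a finite type with pmf p(s), and for each s let p(z1, z2 | s) be a joint pmf of the pair (Z1, Z2) on a finite type Z × Z. For any natural number K ≥ 1 and any critic function f : Z × Z → ℝ, the conditional mutual information satisfies I(Z1; Z2 | S) ≥ ∑_s p(s) · E[ (1/K) ∑_{k=1}^{K} log( exp(f(z1_k, z2_k)) / ( (1/K) ∑_{j=1}^{K} exp(f(z1_j, z2_k)) ) ) ], where the expectation is over K pairs (z1_k, z2_k), k = 1, …, K, drawn independently and identically from p(z1, z2 | s). -/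
/-!
Proposition 1 (InfoNCE lower bound on the client-conditional mutual
information, discrete version).

The client variable `S` has pmf `pS`, and `pC s` is the joint pmf of the pair
`(Z1, Z2)` conditioned on `S = s`.  The joint pmf of `(S, Z1, Z2)` is
`p s z1 z2 = pS s * pC s z1 z2`, and the conditional mutual information
`I(Z1; Z2 | S)` is computed from this joint pmf.  The expectation over `K`
i.i.d. pairs drawn from `pC s` is the finite sum over `Fin K → Z × Z` weighted
by the product of the conditional probabilities.
-/

open Finset

noncomputable section

variable {S Z : Type*} [Fintype S] [Fintype Z]

/-- Conditional mutual information I(Z1; Z2 | S) computed from a joint pmf on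
`S × Z × Z` (curried). Terms with zero joint probability contribute 0. -/
def cmiZ1Z2_S (p : S → Z → Z → ℝ) : ℝ :=
  ∑ s, ∑ z1, ∑ z2, p s z1 z2 *
    Real.log ((p s z1 z2 / (∑ a, ∑ b, p s a b)) /
      (((∑ b, p s z1 b) / (∑ a, ∑ b, p s a b)) *
       ((∑ a, p s a z2) / (∑ a, ∑ b, p s a b))))

/-- Weighted sum over a product space of a function of a single coordinate. -/
lemma sum_pi_prod_mul_apply {ι α : Type*} [Fintype ι] [DecidableEq ι] [Fintype α]
    (q : ι → α → ℝ) (k : ι) (h : α → ℝ) :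
    ∑ y : ι → α, (∏ j, q j (y j)) * h (y k) =
      (∑ a, q k a * h a) * ∏ j ∈ univ.erase k, ∑ a, q j a := by
  have key := Fintype.prod_sum (fun j a => q j a * if j = k then h a else 1)
  rw [← mul_prod_erase _ _ (mem_univ k)] at key
  simp only [if_true, prod_mul_distrib, prod_ite_eq', mem_univ] at key
  rw [← key]
  congr 1
  refine prod_congr rfl fun j hj => ?_
  simp [ne_of_mem_erase hj]

lemma mul_log_le_mul_log_div_add {a m g : ℝ} (ha : 0 ≤ a) (hm : 0 ≤ m)
    (ham : 0 < a → 0 < m) (hg : 0 < g) :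
    a * Real.log g ≤ a * Real.log (a / m) - a + m * g := by
  rcases ha.eq_or_lt with rfl | ha'
  · simpa using mul_nonneg hm hg.le
  have hm' := ham ha'
  have h1 := Real.log_le_sub_one_of_pos (show 0 < g * m / a by positivity)
  rw [Real.log_div (by positivity) ha'.ne', Real.log_mul hg.ne' hm'.ne'] at h1
  rw [Real.log_div ha'.ne' hm'.ne']
  have h2 := mul_le_mul_of_nonneg_left h1 ha
  have h3 : a * (g * m / a - 1) = m * g - a := by field_simp
  rw [h3] at h2
  linarith

/-- Replacing the law of the `k`-th pair by the product of its marginals makes all first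
coordinates i.i.d. and independent of the `k`-th second coordinate. -/
lemma sum_marginals_mul_prod_erase {ι : Type*} [Fintype ι] [DecidableEq ι]
    (p : Z → Z → ℝ) (k : ι) (h : (ι → Z) → Z → ℝ) :
    ∑ v : ι → Z × Z, ((∑ b, p (v k).1 b) * (∑ a, p a (v k).2)) *
        (∏ j ∈ univ.erase k, p (v j).1 (v j).2) * h (fun j => (v j).1) (v k).2 =
      ∑ x : ι → Z, ∑ z, (∏ j, ∑ b, p (x j) b) * ((∑ a, p a z) * h x z) := by
  rw [← (Equiv.arrowProdEquivProdArrow ι (fun _ => Z) (fun _ => Z)).symm.sum_comp,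
    Fintype.sum_prod_type]
  refine sum_congr rfl fun x _ => ?_
  have key := sum_pi_prod_mul_apply
    (fun j y => if j = k then (∑ b, p (x k) b) * ∑ a, p a y else p (x j) y) k (h x)
  have hl (y : ι → Z) : ∏ j, (if j = k then (∑ b, p (x k) b) * ∑ a, p a (y j)
      else p (x j) (y j)) =
      ((∑ b, p (x k) b) * ∑ a, p a (y k)) * ∏ j ∈ univ.erase k, p (x j) (y j) := by
    rw [← mul_prod_erase _ _ (mem_univ k), if_pos rfl]
    congr 1
    exact prod_congr rfl fun j hj => if_neg (ne_of_mem_erase hj)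
  have hr : ∏ j ∈ univ.erase k, ∑ z, (if j = k then (∑ b, p (x k) b) * ∑ a, p a z
      else p (x j) z) = ∏ j ∈ univ.erase k, ∑ z, p (x j) z :=
    prod_congr rfl fun j hj => by simp [ne_of_mem_erase hj]
  simp only [hl, hr, if_true] at key
  refine key.trans ?_
  rw [← mul_prod_erase _ (fun j => ∑ b, p (x j) b) (mem_univ k), sum_mul]
  exact sum_congr rfl fun z _ => by ring

/-- The InfoNCE bound for the unconditional mutual information. -/
lemma infoNCE_le_mutualInformation (p : Z → Z → ℝ) (hp : ∀ a b, 0 ≤ p a b)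
    (hsum : ∑ a, ∑ b, p a b = 1) (K : ℕ) (hK : 1 ≤ K) (f : Z → Z → ℝ) :
    ∑ v : Fin K → Z × Z, (∏ k, p (v k).1 (v k).2) *
        ((1 / (K : ℝ)) * ∑ k : Fin K,
          Real.log (Real.exp (f (v k).1 (v k).2) /
            ((1 / (K : ℝ)) * ∑ j : Fin K, Real.exp (f (v j).1 (v k).2)))) ≤
      ∑ z1, ∑ z2, p z1 z2 *
        Real.log (p z1 z2 / ((∑ b, p z1 b) * (∑ a, p a z2))) := by
  have hK0 : (0 : ℝ) < K := by exact_mod_cast hK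
  have : NeZero K := ⟨by lia⟩
  set I := ∑ z1, ∑ z2, p z1 z2 * Real.log (p z1 z2 / ((∑ b, p z1 b) * (∑ a, p a z2)))
    with hI
  let g (k : Fin K) (x : Fin K → Z) (z : Z) : ℝ :=
    Real.exp (f (x k) z) / ((1 / (K : ℝ)) * ∑ j : Fin K, Real.exp (f (x j) z))
  have hden (x : Fin K → Z) (z : Z) : 0 < ∑ j : Fin K, Real.exp (f (x j) z) :=
    sum_pos (fun _ _ => Real.exp_pos _) univ_nonempty
  have hg (k x z) : 0 < g k x z := by
    have := hden x z
    positivity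
  have hgsum (x z) : ∑ k, g k x z = K := by
    have := (hden x z).ne'
    simp only [g, ← sum_div]
    field_simp
  have hmarg (k : Fin K) (φ : Z × Z → ℝ) :
      ∑ v : Fin K → Z × Z, (∏ j, p (v j).1 (v j).2) * φ (v k) =
        ∑ z1, ∑ z2, p z1 z2 * φ (z1, z2) := by
    rw [sum_pi_prod_mul_apply (fun _ (a : Z × Z) => p a.1 a.2) k φ]
    simp only [Fintype.sum_prod_type, hsum, prod_const_one, mul_one]
  have hstep (k : Fin K) : ∑ v : Fin K → Z × Z, (∏ j, p (v j).1 (v j).2) *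
      Real.log (g k (fun j => (v j).1) (v k).2) ≤
      I - 1 + ∑ x : Fin K → Z, ∑ z, (∏ j, ∑ b, p (x j) b) *
        ((∑ a, p a z) * g k x z) := by
    have h1 := hmarg k fun a => Real.log (p a.1 a.2 / ((∑ b, p a.1 b) * (∑ b, p b a.2)))
    have h2 := hmarg k fun _ => 1
    simp only [mul_one, hsum] at h2
    rw [← sum_marginals_mul_prod_erase, hI, ← h1, ← h2, ← sum_sub_distrib,
      ← sum_add_distrib]
    refine sum_le_sum fun v _ => ?_
    have hR : 0 ≤ ∏ j ∈ univ.erase k, p (v j).1 (v j).2 := prod_nonneg fun _ _ => hp _ _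
    rw [← mul_prod_erase _ _ (mem_univ k)]
    have h3 := mul_log_le_mul_log_div_add (hp (v k).1 (v k).2)
      (m := (∑ b, p (v k).1 b) * (∑ b, p b (v k).2))
      (mul_nonneg (sum_nonneg fun _ _ => hp _ _) (sum_nonneg fun _ _ => hp _ _))
      (fun h => mul_pos
        (h.trans_le (single_le_sum (f := fun b => p (v k).1 b) (fun _ _ => hp _ _)
          (mem_univ _)))
        (h.trans_le (single_le_sum (f := fun b => p b (v k).2) (fun _ _ => hp _ _)
          (mem_univ _))))
      (hg k (fun j => (v j).1) (v k).2)
    have h4 := mul_le_mul_of_nonneg_left h3 hR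
    linarith
  have htotal : ∑ k, ∑ x : Fin K → Z, ∑ z, (∏ j, ∑ b, p (x j) b) *
      ((∑ a, p a z) * g k x z) = K := by
    rw [sum_comm]
    have h1 (x : Fin K → Z) : ∑ k, ∑ z, (∏ j, ∑ b, p (x j) b) *
        ((∑ a, p a z) * g k x z) = (∏ j, ∑ b, p (x j) b) * K := by
      rw [sum_comm]
      simp only [← mul_sum, hgsum, ← sum_mul]
      rw [sum_comm, hsum, one_mul]
    have h2 := Fintype.prod_sum (fun (_ : Fin K) a => ∑ b, p a b)
    simp only [hsum, prod_const_one] at h2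
    rw [sum_congr rfl fun x _ => h1 x, ← sum_mul, ← h2, one_mul]
  have hall := sum_le_sum fun k (_ : k ∈ univ) => hstep k
  rw [sum_add_distrib, htotal, sum_const, card_univ, Fintype.card_fin, nsmul_eq_mul,
    sum_comm] at hall
  simp only [← mul_sum] at hall
  have hfin : ∑ v : Fin K → Z × Z, (∏ k, p (v k).1 (v k).2) * ((1 / (K : ℝ)) *
      ∑ k, Real.log (g k (fun j => (v j).1) (v k).2)) = (1 / (K : ℝ)) *
      ∑ v : Fin K → Z × Z, (∏ k, p (v k).1 (v k).2) *
        ∑ k, Real.log (g k (fun j => (v j).1) (v k).2) := by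
    rw [mul_sum]
    exact sum_congr rfl fun v _ => by ring
  refine hfin.trans_le ?_
  rw [one_div, inv_mul_le_iff₀ hK0]
  linarith

/-- Proposition 1: the InfoNCE objective, averaged over clients, lower bounds
the client-conditional mutual information. -/
theorem infoNCE_lower_bound
    (pS : S → ℝ) (pC : S → Z → Z → ℝ)
    (hpS_nonneg : ∀ s, 0 ≤ pS s) (hpS_sum : ∑ s, pS s = 1)
    (hpC_nonneg : ∀ s z1 z2, 0 ≤ pC s z1 z2)
    (hpC_sum : ∀ s, ∑ z1, ∑ z2, pC s z1 z2 = 1)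
    (K : ℕ) (hK : 1 ≤ K) (f : Z → Z → ℝ) :
    cmiZ1Z2_S (fun s z1 z2 => pS s * pC s z1 z2) ≥
      ∑ s, pS s *
        ∑ v : Fin K → Z × Z, (∏ k, pC s (v k).1 (v k).2) *
          ((1 / (K : ℝ)) * ∑ k : Fin K,
            Real.log (Real.exp (f (v k).1 (v k).2) /
              ((1 / (K : ℝ)) * ∑ j : Fin K, Real.exp (f (v j).1 (v k).2)))) := by
  refine sum_le_sum fun s _ => ?_
  rcases (hpS_nonneg s).eq_or_lt with h0 | h0
  · simp [← h0]
  refine (mul_le_mul_of_nonneg_left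
    (infoNCE_le_mutualInformation (pC s) (hpC_nonneg s) (hpC_sum s) K hK f)
    (hpS_nonneg s)).trans_eq ?_
  simp only [← mul_sum, hpC_sum, mul_one, mul_div_cancel_left₀ _ h0.ne', mul_assoc]

end
end

section
/- Proposition 2 (the user-verification loss lower-bounds the label information under label skew): Let S, Y, Z1, Z2 be jointly distributed random variables on finite types such that Z1 and S are conditionally independent given Y, and Z2 and S are conditionally independent given Y (equivalently, I(Z1; S | Y) = 0 and I(Z2; S | Y) = 0). Let r(s | z) be any conditional probability mass function over the values of S such that r(s | z) > 0 whenever P(S=s, Z1=z) > 0 or P(S=s, Z2=z) > 0. Then I(Z1; Y) + I(Z2; Y) ≥ ∑_{s,z1,z2} P(S=s, Z1=z1, Z2=z2) · ( log r(s | z1) + log r(s | z2) ) + 2 · H(S). -/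
/-!
Proposition 2 (the user-verification loss lower-bounds the label information
under label skew): For jointly distributed `S, Y, Z1, Z2` (with `Z1, Z2` valued
in the same finite type `Z`, so that a single client classifier `r (s | z)`
applies to both views) such that `Z1 ⊥ S | Y` and `Z2 ⊥ S | Y` (expressed
equivalently as I(Z1; S | Y) = 0 and I(Z2; S | Y) = 0),
I(Z1; Y) + I(Z2; Y) ≥
  ∑_{s,z1,z2} P(S=s, Z1=z1, Z2=z2) · (log r(s|z1) + log r(s|z2)) + 2 H(S).
-/

open Finset

noncomputable section

variable {S Y Z : Type*} [Fintype S] [Fintype Y] [Fintype Z]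

/-- Marginal P(S = s). -/
def margS (p : S → Y → Z → Z → ℝ) (s : S) : ℝ := ∑ y, ∑ z1, ∑ z2, p s y z1 z2

/-- Marginal P(Y = y). -/
def margY (p : S → Y → Z → Z → ℝ) (y : Y) : ℝ := ∑ s, ∑ z1, ∑ z2, p s y z1 z2

/-- Marginal P(Z1 = z1). -/
def margZ1 (p : S → Y → Z → Z → ℝ) (z1 : Z) : ℝ := ∑ s, ∑ y, ∑ z2, p s y z1 z2

/-- Marginal P(Z2 = z2). -/
def margZ2 (p : S → Y → Z → Z → ℝ) (z2 : Z) : ℝ := ∑ s, ∑ y, ∑ z1, p s y z1 z2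

/-- Marginal P(S = s, Y = y). -/
def margSY (p : S → Y → Z → Z → ℝ) (s : S) (y : Y) : ℝ := ∑ z1, ∑ z2, p s y z1 z2

/-- Marginal P(Y = y, Z1 = z1). -/
def margYZ1 (p : S → Y → Z → Z → ℝ) (y : Y) (z1 : Z) : ℝ := ∑ s, ∑ z2, p s y z1 z2

/-- Marginal P(Y = y, Z2 = z2). -/
def margYZ2 (p : S → Y → Z → Z → ℝ) (y : Y) (z2 : Z) : ℝ := ∑ s, ∑ z1, p s y z1 z2

/-- Marginal P(S = s, Z1 = z1). -/
def margSZ1 (p : S → Y → Z → Z → ℝ) (s : S) (z1 : Z) : ℝ := ∑ y, ∑ z2, p s y z1 z2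

/-- Marginal P(S = s, Z2 = z2). -/
def margSZ2 (p : S → Y → Z → Z → ℝ) (s : S) (z2 : Z) : ℝ := ∑ y, ∑ z1, p s y z1 z2

/-- Marginal P(S = s, Z1 = z1, Z2 = z2). -/
def margSZ1Z2 (p : S → Y → Z → Z → ℝ) (s : S) (z1 z2 : Z) : ℝ := ∑ y, p s y z1 z2

/-- Marginal P(S = s, Y = y, Z1 = z1). -/
def margSYZ1 (p : S → Y → Z → Z → ℝ) (s : S) (y : Y) (z1 : Z) : ℝ := ∑ z2, p s y z1 z2

/-- Marginal P(S = s, Y = y, Z2 = z2). -/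
def margSYZ2 (p : S → Y → Z → Z → ℝ) (s : S) (y : Y) (z2 : Z) : ℝ := ∑ z1, p s y z1 z2

/-- Mutual information I(Z1; Y). -/
def miZ1Y (p : S → Y → Z → Z → ℝ) : ℝ :=
  ∑ y, ∑ z1, margYZ1 p y z1 * Real.log (margYZ1 p y z1 / (margZ1 p z1 * margY p y))

/-- Mutual information I(Z2; Y). -/
def miZ2Y (p : S → Y → Z → Z → ℝ) : ℝ :=
  ∑ y, ∑ z2, margYZ2 p y z2 * Real.log (margYZ2 p y z2 / (margZ2 p z2 * margY p y))

/-- Conditional mutual information I(Z1; S | Y). -/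
def cmiZ1S_Y (p : S → Y → Z → Z → ℝ) : ℝ :=
  ∑ s, ∑ y, ∑ z1, margSYZ1 p s y z1 *
    Real.log ((margSYZ1 p s y z1 / margY p y) /
      ((margYZ1 p y z1 / margY p y) * (margSY p s y / margY p y)))

/-- Conditional mutual information I(Z2; S | Y). -/
def cmiZ2S_Y (p : S → Y → Z → Z → ℝ) : ℝ :=
  ∑ s, ∑ y, ∑ z2, margSYZ2 p s y z2 *
    Real.log ((margSYZ2 p s y z2 / margY p y) /
      ((margYZ2 p y z2 / margY p y) * (margSY p s y / margY p y)))

/-- Entropy H(S), with the convention 0 · log 0 = 0. -/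
def entS (p : S → Y → Z → Z → ℝ) : ℝ := -∑ s, margS p s * Real.log (margS p s)

/-- The density bound behind the Gibbs inequality: `a - b ≤ a * log (a / b)`. -/
lemma sub_le_mul_log_div {a b : ℝ} (ha : 0 < a) (hb : 0 < b) :
    a - b ≤ a * Real.log (a / b) := by
  have h := Real.log_le_sub_one_of_pos (div_pos hb ha)
  rw [← inv_div a b, Real.log_inv, inv_div] at h
  have h' := mul_le_mul_of_nonneg_left h ha.le
  have e : a * (b / a - 1) = b - a := by field_simp
  linarith

lemma margSYZ1_nonneg {A B : Type*} {p : A → B → Z → Z → ℝ}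
    (hp : ∀ s y z1 z2, 0 ≤ p s y z1 z2) (s : A) (y : B) (z : Z) : 0 ≤ margSYZ1 p s y z :=
  sum_nonneg fun _ _ => hp ..

/-- The Gibbs inequality for the distribution `P(S, Y, Z1)` and the weights
`P(Z1 = z) * P(Y = y | S = s) * r z s`. -/
lemma margSYZ1_sub_le {p : S → Y → Z → Z → ℝ} (hp : ∀ s y z1 z2, 0 ≤ p s y z1 z2)
    {r : Z → S → ℝ} (hr : ∀ z s, 0 ≤ r z s)
    (hr_pos : ∀ s z, 0 < margSZ1 p s z → 0 < r z s) (s : S) (y : Y) (z : Z) :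
    margSYZ1 p s y z - margZ1 p z * (margSY p s y / margS p s) * r z s ≤
      margSYZ1 p s y z * Real.log (margYZ1 p y z / (margZ1 p z * margY p y)) +
      margSYZ1 p s y z * Real.log ((margSYZ1 p s y z / margY p y) /
        ((margYZ1 p y z / margY p y) * (margSY p s y / margY p y))) -
      margSYZ1 p s y z * Real.log (r z s) +
      margSYZ1 p s y z * Real.log (margS p s) := by
  have q0 := margSYZ1_nonneg hp
  have hSY (s : S) (y : Y) : 0 ≤ margSY p s y := sum_nonneg fun z _ => q0 s y z
  have hYZ (y : Y) (z : Z) : 0 ≤ margYZ1 p y z := sum_nonneg fun s _ => q0 s y z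
  have hSZ (s : S) (z : Z) : 0 ≤ margSZ1 p s z := sum_nonneg fun y _ => q0 s y z
  have hS : 0 ≤ margS p s := sum_nonneg fun y _ => hSY s y
  have hZ : 0 ≤ margZ1 p z := sum_nonneg fun s _ => hSZ s z
  rcases (q0 s y z).eq_or_lt with h | h
  · rw [← h]
    have := mul_nonneg (mul_nonneg hZ (div_nonneg (hSY s y) hS)) (hr z s)
    linarith
  have pSY : 0 < margSY p s y :=
    h.trans_le (single_le_sum (f := fun z => margSYZ1 p s y z) (fun z _ => q0 s y z) (mem_univ z))
  have pYZ : 0 < margYZ1 p y z :=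
    h.trans_le (single_le_sum (f := fun s => margSYZ1 p s y z) (fun s _ => q0 s y z) (mem_univ s))
  have pSZ : 0 < margSZ1 p s z :=
    h.trans_le (single_le_sum (f := fun y => margSYZ1 p s y z) (fun y _ => q0 s y z) (mem_univ y))
  have pS : 0 < margS p s :=
    pSY.trans_le (single_le_sum (f := fun y => margSY p s y) (fun y _ => hSY s y) (mem_univ y))
  have pY : 0 < margY p y :=
    pSY.trans_le (single_le_sum (f := fun s => margSY p s y) (fun s _ => hSY s y) (mem_univ s))
  have pZ : 0 < margZ1 p z :=
    pSZ.trans_le (single_le_sum (f := fun s => margSZ1 p s z) (fun s _ => hSZ s z) (mem_univ s))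
  have pr := hr_pos s z pSZ
  refine (sub_le_mul_log_div h (by positivity)).trans_eq ?_
  rw [← mul_add, ← mul_sub, ← mul_add]
  congr 1
  rw [← Real.log_mul (by positivity) (by positivity), ← Real.log_div (by positivity) pr.ne',
    ← Real.log_mul (by positivity) pS.ne']
  congr 1
  field_simp

/-- `I(Z1; Y) + I(Z1; S | Y)` bounds the variational lower bound on `I(Z1; S)` given by `r`. -/
lemma sum_log_add_entS_le {p : S → Y → Z → Z → ℝ} (hp : ∀ s y z1 z2, 0 ≤ p s y z1 z2)
    {r : Z → S → ℝ} (hr : ∀ z s, 0 ≤ r z s) (hr_sum : ∀ z, ∑ s, r z s = 1)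
    (hr_pos : ∀ s z, 0 < margSZ1 p s z → 0 < r z s) :
    (∑ s, ∑ z, margSZ1 p s z * Real.log (r z s)) + entS p ≤ miZ1Y p + cmiZ1S_Y p := by
  have q0 := margSYZ1_nonneg hp
  have hZ (z : Z) : 0 ≤ margZ1 p z :=
    sum_nonneg fun s _ => sum_nonneg fun y _ => q0 s y z
  have key := sum_le_sum fun s (_ : s ∈ univ) => sum_le_sum fun y (_ : y ∈ univ) =>
    sum_le_sum fun z (_ : z ∈ univ) => margSYZ1_sub_le hp hr hr_pos s y z
  simp only [sum_add_distrib, sum_sub_distrib] at key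
  have hmi : miZ1Y p = ∑ s, ∑ y, ∑ z, margSYZ1 p s y z *
      Real.log (margYZ1 p y z / (margZ1 p z * margY p y)) := by
    symm
    rw [sum_comm]
    refine sum_congr rfl fun y _ => ?_
    rw [sum_comm]
    refine sum_congr rfl fun z _ => ?_
    rw [← sum_mul]
    rfl
  have hlog : ∑ s, ∑ z, margSZ1 p s z * Real.log (r z s) =
      ∑ s, ∑ y, ∑ z, margSYZ1 p s y z * Real.log (r z s) := by
    refine sum_congr rfl fun s _ => ?_
    rw [sum_comm]
    refine sum_congr rfl fun z _ => ?_
    rw [← sum_mul]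
    rfl
  have hent : entS p = -∑ s, ∑ y, ∑ z, margSYZ1 p s y z * Real.log (margS p s) := by
    simp_rw [← sum_mul]
    rfl
  have htotal : ∑ s, ∑ y, ∑ z, margSYZ1 p s y z = ∑ z, margZ1 p z :=
    (sum_congr rfl fun _ _ => sum_comm).trans sum_comm
  have hweight : ∑ s, ∑ y, ∑ z, margZ1 p z * (margSY p s y / margS p s) * r z s ≤
      ∑ z, margZ1 p z := by
    calc _ = ∑ s, ∑ z, margZ1 p z * r z s * (margS p s / margS p s) := by
          refine sum_congr rfl fun s _ => ?_
          rw [sum_comm]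
          refine sum_congr rfl fun z _ => ?_
          rw [← sum_mul, ← mul_sum, ← sum_div, mul_right_comm]
          rfl
      _ ≤ ∑ s, ∑ z, margZ1 p z * r z s :=
          sum_le_sum fun s _ => sum_le_sum fun z _ =>
            mul_le_of_le_one_right (mul_nonneg (hZ z) (hr z s)) (div_self_le_one _)
      _ = ∑ z, margZ1 p z := by
          rw [sum_comm]
          simp_rw [← mul_sum, hr_sum, mul_one]
  rw [hmi, hlog, hent, cmiZ1S_Y]
  linarith

/-- The same distribution with the roles of the two views exchanged. -/
def swapViews (p : S → Y → Z → Z → ℝ) : S → Y → Z → Z → ℝ := fun s y z1 z2 => p s y z2 z1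

lemma margSY_swapViews {A B : Type*} (p : A → B → Z → Z → ℝ) :
    margSY (swapViews p) = margSY p := by
  funext s y
  exact sum_comm

lemma margS_swapViews {A : Type*} (p : A → Y → Z → Z → ℝ) : margS (swapViews p) = margS p := by
  funext s
  exact sum_congr rfl fun y _ => congrFun₂ (margSY_swapViews p) s y

lemma margY_swapViews {B : Type*} (p : S → B → Z → Z → ℝ) : margY (swapViews p) = margY p := by
  funext y
  exact sum_congr rfl fun s _ => congrFun₂ (margSY_swapViews p) s y

lemma entS_swapViews (p : S → Y → Z → Z → ℝ) : entS (swapViews p) = entS p := by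
  simp only [entS, margS_swapViews]

lemma miZ1Y_swapViews (p : S → Y → Z → Z → ℝ) : miZ1Y (swapViews p) = miZ2Y p := by
  simp only [miZ1Y, margY_swapViews]
  rfl

lemma cmiZ1S_Y_swapViews (p : S → Y → Z → Z → ℝ) : cmiZ1S_Y (swapViews p) = cmiZ2S_Y p := by
  simp only [cmiZ1S_Y, margY_swapViews, margSY_swapViews]
  rfl

lemma sum_margSZ1Z2_mul_add (p : S → Y → Z → Z → ℝ) (f : Z → S → ℝ) :
    ∑ s, ∑ z1, ∑ z2, margSZ1Z2 p s z1 z2 * (f z1 s + f z2 s) =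
      (∑ s, ∑ z, margSZ1 p s z * f z s) + ∑ s, ∑ z, margSZ2 p s z * f z s := by
  rw [← sum_add_distrib]
  refine sum_congr rfl fun s _ => ?_
  simp only [mul_add, sum_add_distrib]
  congr 1
  · refine sum_congr rfl fun z _ => ?_
    rw [← sum_mul, margSZ1, sum_comm]
    rfl
  · rw [sum_comm]
    refine sum_congr rfl fun z _ => ?_
    rw [← sum_mul, margSZ2, sum_comm]
    rfl

/-- Proposition 2. -/
theorem uv_lower_bounds_label_information
    (p : S → Y → Z → Z → ℝ)
    (hp_nonneg : ∀ s y z1 z2, 0 ≤ p s y z1 z2)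
    (hp_sum : ∑ s, ∑ y, ∑ z1, ∑ z2, p s y z1 z2 = 1)
    (hci1 : cmiZ1S_Y p = 0) (hci2 : cmiZ2S_Y p = 0)
    (r : Z → S → ℝ)
    (hr_nonneg : ∀ z s, 0 ≤ r z s)
    (hr_sum : ∀ z, ∑ s, r z s = 1)
    (hr_pos : ∀ s z, 0 < margSZ1 p s z ∨ 0 < margSZ2 p s z → 0 < r z s) :
    miZ1Y p + miZ2Y p ≥
      (∑ s, ∑ z1, ∑ z2, margSZ1Z2 p s z1 z2 *
        (Real.log (r z1 s) + Real.log (r z2 s))) + 2 * entS p := by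
  have h1 := sum_log_add_entS_le hp_nonneg hr_nonneg hr_sum fun s z h => hr_pos s z (.inl h)
  have h2 := sum_log_add_entS_le (p := swapViews p) (fun s y z1 z2 => hp_nonneg s y z2 z1)
    hr_nonneg hr_sum fun s z h => hr_pos s z (.inr h)
  rw [entS_swapViews, miZ1Y_swapViews, cmiZ1S_Y_swapViews, hci2] at h2
  change (∑ s, ∑ z, margSZ2 p s z * Real.log (r z s)) + entS p ≤ _ at h2
  rw [hci1] at h1
  rw [sum_margSZ1Z2_mul_add p fun z s => Real.log (r z s)]
  linarith

end
end
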